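/- Let σ ⊆ ℝ² be a 2-dimensional rational polyhedral cone whose two primitive ray generators do not form a ℤ-basis of ℤ² (a singular cone). Then there exist a ℤ-basis {e₁, e₂} of ℤ² and integers d > k > 0 with gcd(d,k) = 1 such that σ = Cone(e₁, k·e₁ + d·e₂); that is, every singular 2-dimensional cone is a (d,k)-cone. -/

import Mathlib

open MeasureTheory

/-- The standard lattice `ℤ²` inside `ℝ²`. -/
def Lat2 : Set (Fin 2 → ℝ) := {x | ∀ j, ∃ m : ℤ, x j = (m : ℝ)}

/-- `{e₁, e₂}` is a ℤ-basis of the lattice `ℤ² ⊆ ℝ²`, i.e. the two vectors are lattice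
vectors generating `ℤ²` as a ℤ-module. -/
def IsZBasis (e₁ e₂ : Fin 2 → ℝ) : Prop :=
  e₁ ∈ Lat2 ∧ e₂ ∈ Lat2 ∧ ∀ x ∈ Lat2, ∃ a b : ℤ, x = a • e₁ + b • e₂

/-- `u` is a primitive lattice vector: its (integer) coordinates have gcd `1`. -/
def IsPrimitive (u : Fin 2 → ℝ) : Prop :=
  ∃ a b : ℤ, u 0 = (a : ℝ) ∧ u 1 = (b : ℝ) ∧ Int.gcd a b = 1

/-- The cone spanned by two vectors: `Cone(u,v) = ℝ≥0·u + ℝ≥0·v`. -/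
def coneTwo (u v : Fin 2 → ℝ) : Set (Fin 2 → ℝ) :=
  {x | ∃ a b : ℝ, 0 ≤ a ∧ 0 ≤ b ∧ x = a • u + b • v}

/-- Matsui–Takeuchi's normalized relative subdiagram volume of a plane cone `σ` at its
apex: twice the Lebesgue measure of `σ ∖ conv((σ ∖ {0}) ∩ ℤ²)`. -/
noncomputable def RSV (σ : Set (Fin 2 → ℝ)) : ℝ :=
  2 * (volume (σ \ convexHull ℝ ((σ \ {0}) ∩ Lat2))).toReal

theorem zbasis_of_det (p q : Fin 2 → ℝ) (a b c e : ℤ) (h0 : p 0 = a) (h1 : p 1 = b)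
    (h2 : q 0 = c) (h3 : q 1 = e) (hD : (a * e - b * c) * (a * e - b * c) = 1) :
    IsZBasis p q := by
  refine ⟨?_, ?_, ?_⟩
  · intro j
    fin_cases j
    · exact ⟨a, h0⟩
    · exact ⟨b, h1⟩
  · intro j
    fin_cases j
    · exact ⟨c, h2⟩
    · exact ⟨e, h3⟩
  · intro x hx
    obtain ⟨m, hm⟩ := hx 0
    obtain ⟨n, hn⟩ := hx 1
    have hD' : ((a * e - b * c) * (a * e - b * c) : ℝ) = 1 := by exact_mod_cast hD
    refine ⟨(a * e - b * c) * (m * e - n * c), (a * e - b * c) * (a * n - b * m), ?_⟩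
    funext j
    fin_cases j
    · simp [h0, h2, hm]
      linear_combination (-(m : ℝ)) * hD'
    · simp [h1, h3, hn]
      linear_combination (-(n : ℝ)) * hD'

/-- every singular 2-dimensional rational cone is a `(d,k)`-cone: if the
primitive ray generators `u, v` of a 2-dimensional cone do not form a ℤ-basis of `ℤ²`,
then there are a ℤ-basis `{e₁, e₂}` of `ℤ²` and integers `d > k > 0` with
`gcd(d,k) = 1` such that `Cone(u,v) = Cone(e₁, k·e₁ + d·e₂)`. -/
theorem singular_cone_is_dk_cone (u v : Fin 2 → ℝ)
    (hu : IsPrimitive u) (hv : IsPrimitive v)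
    (hind : LinearIndependent ℝ ![u, v]) (hsing : ¬ IsZBasis u v) :
    ∃ (e₁ e₂ : Fin 2 → ℝ) (d k : ℕ), IsZBasis e₁ e₂ ∧ 0 < k ∧ k < d ∧
      Nat.Coprime d k ∧
      coneTwo u v = coneTwo e₁ ((k : ℝ) • e₁ + (d : ℝ) • e₂) := by
  obtain ⟨a, b, hu0, hu1, hab⟩ := hu
  obtain ⟨c, e, hv0, hv1, hce⟩ := hv
  obtain ⟨x, y, hxy⟩ : IsCoprime a b := Int.isCoprime_iff_gcd_eq_one.mpr hab
  obtain ⟨z, w, hzw⟩ : IsCoprime c e := Int.isCoprime_iff_gcd_eq_one.mpr hce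
  have hD0 : a * e - b * c ≠ 0 := by
    intro h
    have h' : (a * e - b * c : ℝ) = 0 := by exact_mod_cast h
    rw [LinearIndependent.pair_iff] at hind
    have h1 := hind e (-b) (by
      funext j
      fin_cases j
      · simp [hu0, hv0]; linear_combination h'
      · simp [hu1, hv1]; ring)
    have h2 := hind c (-a) (by
      funext j
      fin_cases j
      · simp [hu0, hv0]; ring
      · simp [hu1, hv1]; linear_combination -h')
    have e1 : e = 0 := by exact_mod_cast h1.1
    have e2 : c = 0 := by exact_mod_cast h2.1
    simp [e1, e2] at hzw
  obtain ⟨s, d, hs, hd, hDs⟩ : ∃ (s : ℤ) (d : ℕ), s * s = 1 ∧ 0 < d ∧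
      a * e - b * c = s * d := by
    rcases lt_or_gt_of_ne hD0 with h | h
    · exact ⟨-1, (a * e - b * c).natAbs, by norm_num, by omega, by omega⟩
    · exact ⟨1, (a * e - b * c).natAbs, by norm_num, by omega, by omega⟩
  have hd1 : d ≠ 1 := by
    rintro rfl
    apply hsing
    refine zbasis_of_det u v a b c e hu0 hu1 hv0 hv1 ?_
    rw [hDs]; simpa using hs
  obtain ⟨q, k, hk, hkq⟩ : ∃ (q : ℤ) (k : ℕ), k < d ∧ c * x + e * y = k + q * d := by
    have hp : (0 : ℤ) < d := by exact_mod_cast hd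
    have h1 := Int.emod_nonneg (c * x + e * y) hp.ne'
    have h2 := Int.emod_lt_of_pos (c * x + e * y) hp
    have h3 := Int.emod_add_mul_ediv (c * x + e * y) d
    refine ⟨(c * x + e * y) / d, ((c * x + e * y) % d).toNat, by omega, ?_⟩
    rw [Int.toNat_of_nonneg h1]
    linear_combination -h3
  -- v = k u + d e₂
  have hc : c = k * a + d * (q * a - s * y) := by
    linear_combination a * hkq - y * hDs - c * hxy
  have he : e = k * b + d * (q * b + s * x) := by
    linear_combination b * hkq + x * hDs - e * hxy
  have hcop : Nat.Coprime d k := by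
    rw [← Nat.isCoprime_iff_coprime]
    refine ⟨z * (q * a - s * y) + w * (q * b + s * x), z * a + w * b, ?_⟩
    linear_combination hzw - z * hc - w * he
  have hk0 : 0 < k := by
    rcases Nat.eq_zero_or_pos k with h | h
    · subst h
      simp at hcop
      exact absurd hcop hd1
    · exact h
  let e₂ : Fin 2 → ℝ := ![((q * a - s * y : ℤ) : ℝ), ((q * b + s * x : ℤ) : ℝ)]
  refine ⟨u, e₂, d, k, ?_, hk0, hk, hcop, ?_⟩
  · refine zbasis_of_det u e₂ a b _ _ hu0 hu1 rfl rfl ?_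
    have : a * (q * b + s * x) - b * (q * a - s * y) = s := by
      linear_combination s * hxy
    rw [this, hs]
  · have hveq : v = (k : ℝ) • u + (d : ℝ) • e₂ := by
      funext j
      fin_cases j
      · have : (c : ℝ) = k * a + d * (q * a - s * y) := by exact_mod_cast hc
        simp [e₂, hu0, hv0, this]
      · have : (e : ℝ) = k * b + d * (q * b + s * x) := by exact_mod_cast he
        simp [e₂, hu1, hv1, this]
    rw [← hveq]
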